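/- Let A be an entrywise nonnegative nonzero m×n real matrix, and let I ⊆ {1,…,m}, J ⊆ {1,…,n} with |I| = M and |J| = N. Define ā(I,J) = (1/(MN)) · Σ_{(i,j)∈I×J} a_{ij} and a_max = max_{(i,j)∉I×J} a_{ij}, and suppose ā(I,J) > a_max. Set θ_B = (1/√(MN)) · (ā(I,J)·√(MN) + a_max)/(ā(I,J) − a_max). Then for every θ > θ_B, every optimal solution X of the problem: maximize ⟨A,X⟩ subject to ‖X‖_θ ≤ 1, satisfies x_{ij} = 0 for all (i,j) ∉ I×J. -/

import Mathlib

open scoped BigOperators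

noncomputable section

namespace LAROS

variable {m n : ℕ}

/-- Trace inner product `⟨A,X⟩ = trace(Aᵀ X)`. -/
def mInner (A X : Matrix (Fin m) (Fin n) ℝ) : ℝ := ∑ i, ∑ j, A i j * X i j

/-- `N` is a norm on `m×n` real matrices. -/
def IsMatrixNorm (N : Matrix (Fin m) (Fin n) ℝ → ℝ) : Prop :=
  (∀ X, N X = 0 ↔ X = 0) ∧ (∀ (c : ℝ) (X), N (c • X) = |c| * N X) ∧
    (∀ X Y, N (X + Y) ≤ N X + N Y)

/-- Dual norm of `N`. -/
def dualNorm (N : Matrix (Fin m) (Fin n) ℝ → ℝ) (A : Matrix (Fin m) (Fin n) ℝ) : ℝ :=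
  sSup {r | ∃ Y, N Y ≤ 1 ∧ r = mInner A Y}

/-- `X` is optimal for: minimize `N X` subject to `⟨A,X⟩ ≥ 1`. -/
def IsOptMin (N : Matrix (Fin m) (Fin n) ℝ → ℝ) (A X : Matrix (Fin m) (Fin n) ℝ) : Prop :=
  1 ≤ mInner A X ∧ ∀ X', 1 ≤ mInner A X' → N X ≤ N X'

/-- `Y` is optimal for: maximize `⟨A,Y⟩` subject to `N Y ≤ 1`. -/
def IsOptMax (N : Matrix (Fin m) (Fin n) ℝ → ℝ) (A Y : Matrix (Fin m) (Fin n) ℝ) : Prop :=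
  N Y ≤ 1 ∧ ∀ Y', N Y' ≤ 1 → mInner A Y' ≤ mInner A Y

/-- Subdifferential of `f : ℝ^{m×n} → ℝ` at `A`, with respect to the trace inner product. -/
def subdiff (f : Matrix (Fin m) (Fin n) ℝ → ℝ) (A : Matrix (Fin m) (Fin n) ℝ) :
    Set (Matrix (Fin m) (Fin n) ℝ) :=
  {Y | ∀ B, f A + mInner (B - A) Y ≤ f B}

/-- The spectral norm (largest singular value) of an `m×n` real matrix. -/
def spectralNorm (A : Matrix (Fin m) (Fin n) ℝ) : ℝ :=
  sSup {r | ∃ (u : Fin m → ℝ) (v : Fin n → ℝ),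
    (∑ i, u i ^ 2) ≤ 1 ∧ (∑ j, v j ^ 2) ≤ 1 ∧ r = ∑ i, ∑ j, u i * A i j * v j}

/-- The nuclear norm (sum of singular values), as the dual norm of the spectral norm. -/
def nuclearNorm (A : Matrix (Fin m) (Fin n) ℝ) : ℝ := dualNorm spectralNorm A

/-- Entrywise ℓ1 norm: sum of absolute values of all entries. -/
def l1Norm (X : Matrix (Fin m) (Fin n) ℝ) : ℝ := ∑ i, ∑ j, |X i j|

/-- Entrywise max norm: maximum absolute value of an entry. -/
def maxNorm (X : Matrix (Fin m) (Fin n) ℝ) : ℝ := sSup {r | ∃ i j, r = |X i j|}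

/-- The norm `‖X‖_θ = ‖X‖_* + θ‖X‖₁`. -/
def thetaNorm (θ : ℝ) (X : Matrix (Fin m) (Fin n) ℝ) : ℝ := nuclearNorm X + θ * l1Norm X

/-- The value of the bilinear form of `A` at vectors of the unit balls is at most `spectralNorm A`. -/
theorem bilinear_le_spectralNorm (A : Matrix (Fin m) (Fin n) ℝ) {u : Fin m → ℝ} {v : Fin n → ℝ}
    (hu : ∑ i, u i ^ 2 ≤ 1) (hv : ∑ j, v j ^ 2 ≤ 1) :
    ∑ i, ∑ j, u i * A i j * v j ≤ spectralNorm A := by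
  have abs_le_one : ∀ {k : ℕ} {w : Fin k → ℝ}, ∑ i, w i ^ 2 ≤ 1 → ∀ i, |w i| ≤ 1 := by
    intro k w hw i
    have := Finset.single_le_sum (f := fun i => w i ^ 2) (fun i _ => sq_nonneg (w i))
      (Finset.mem_univ i)
    exact (sq_le_one_iff_abs_le_one _).1 (this.trans hw)
  refine le_csSup ⟨∑ i, ∑ j, |A i j|, ?_⟩ ⟨u, v, hu, hv, rfl⟩
  rintro r ⟨u, v, hu, hv, rfl⟩
  refine Finset.sum_le_sum fun i _ => Finset.sum_le_sum fun j _ => ?_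
  calc u i * A i j * v j ≤ |u i * A i j * v j| := le_abs_self _
    _ = |A i j| * (|u i| * |v j|) := by rw [abs_mul, abs_mul]; ring
    _ ≤ |A i j| * 1 := by
        have := mul_le_one₀ (abs_le_one hu i) (abs_nonneg (v j)) (abs_le_one hv j)
        gcongr
    _ = |A i j| := mul_one _

/-- Every entry of a matrix is bounded in absolute value by its spectral norm. -/
theorem abs_apply_le_spectralNorm (A : Matrix (Fin m) (Fin n) ℝ) (i : Fin m) (j : Fin n) :
    |A i j| ≤ spectralNorm A := by
  have key : ∀ c : ℝ, c ^ 2 ≤ 1 → c * A i j ≤ spectralNorm A := by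
    intro c hc
    have := bilinear_le_spectralNorm A (u := Pi.single i c) (v := Pi.single j 1)
      (by simpa [Pi.single_apply, ite_pow] using hc) (by simp [Pi.single_apply, ite_pow])
    simpa [Pi.single_apply] using this
  exact abs_le'.2 ⟨by simpa using key 1 (by norm_num), by simpa using key (-1) (by norm_num)⟩

/-- The sum of the entries of an `M×N` block is at most `√(MN)` times the spectral norm. -/
theorem sum_block_le_spectralNorm (A : Matrix (Fin m) (Fin n) ℝ) {I : Finset (Fin m)}
    {J : Finset (Fin n)} (hI : I.Nonempty) (hJ : J.Nonempty) :
    ∑ i ∈ I, ∑ j ∈ J, A i j ≤ √((I.card : ℝ) * J.card) * spectralNorm A := by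
  have hM : (0 : ℝ) < I.card := by exact_mod_cast hI.card_pos
  have hN : (0 : ℝ) < J.card := by exact_mod_cast hJ.card_pos
  have h := bilinear_le_spectralNorm A
    (u := fun i => if i ∈ I then (√(I.card : ℝ))⁻¹ else 0)
    (v := fun j => if j ∈ J then (√(J.card : ℝ))⁻¹ else 0)
    (by simp [ite_pow, inv_pow, Real.sq_sqrt hM.le, hM.ne'])
    (by simp [ite_pow, inv_pow, Real.sq_sqrt hN.le, hN.ne'])
  have hs : ∑ i, ∑ j, (if i ∈ I then (√(I.card : ℝ))⁻¹ else 0) * A i j *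
      (if j ∈ J then (√(J.card : ℝ))⁻¹ else 0) =
      (√((I.card : ℝ) * J.card))⁻¹ * ∑ i ∈ I, ∑ j ∈ J, A i j := by
    simp only [ite_mul, mul_ite, zero_mul, mul_zero, Finset.sum_ite_mem, Finset.univ_inter,
      Finset.mul_sum, Real.sqrt_mul hM.le, mul_inv]
    rw [← Finset.sum_subset (Finset.subset_univ I) (fun i _ hi => by simp [hi])]
    refine Finset.sum_congr rfl fun i hi => ?_
    simp only [hi, if_true]
    exact Finset.sum_congr rfl fun j _ => by ring
  rw [hs] at h
  have hpos : 0 < √((I.card : ℝ) * J.card) := Real.sqrt_pos.2 (mul_pos hM hN)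
  exact (inv_mul_le_iff₀ hpos).1 h

theorem mInner_add_left (X Z Y : Matrix (Fin m) (Fin n) ℝ) :
    mInner (X + Z) Y = mInner X Y + mInner Z Y := by
  simp [mInner, add_mul, Finset.sum_add_distrib]

/-- A pairing of `X` with a matrix of spectral norm at most one is at most `nuclearNorm X`. -/
theorem mInner_le_nuclearNorm (X : Matrix (Fin m) (Fin n) ℝ) {Y : Matrix (Fin m) (Fin n) ℝ}
    (hY : spectralNorm Y ≤ 1) : mInner X Y ≤ nuclearNorm X := by
  refine le_csSup ⟨l1Norm X, ?_⟩ ⟨Y, hY, rfl⟩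
  rintro r ⟨Y, hY, rfl⟩
  refine Finset.sum_le_sum fun i _ => Finset.sum_le_sum fun j _ => ?_
  calc X i j * Y i j ≤ |X i j| * |Y i j| := (le_abs_self _).trans (abs_mul _ _).le
    _ ≤ |X i j| := mul_le_of_le_one_right (abs_nonneg _)
        ((abs_apply_le_spectralNorm Y i j).trans hY)

/-- Adding `Z` increases the nuclear norm by at most any bound on the pairings of `Z` with the
spectral unit ball. -/
theorem nuclearNorm_add_le (X Z : Matrix (Fin m) (Fin n) ℝ) {c : ℝ}
    (hZ : ∀ Y, spectralNorm Y ≤ 1 → mInner Z Y ≤ c) :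
    nuclearNorm (X + Z) ≤ nuclearNorm X + c := by
  have h0 : spectralNorm (0 : Matrix (Fin m) (Fin n) ℝ) ≤ 1 := by
    refine Real.sSup_le ?_ zero_le_one
    rintro r ⟨u, v, -, -, rfl⟩
    simp
  refine csSup_le ⟨_, 0, h0, rfl⟩ ?_
  rintro r ⟨Y, hY, rfl⟩
  rw [mInner_add_left]
  exact add_le_add (mInner_le_nuclearNorm X hY) (hZ Y hY)

/-- The matrix equal to `k` on the block `I×J`, minus `x` at the entry `(i,j)`. -/
def blockSubEntry (I : Finset (Fin m)) (J : Finset (Fin n)) (k : ℝ) (i : Fin m) (j : Fin n)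
    (x : ℝ) : Matrix (Fin m) (Fin n) ℝ :=
  Matrix.of fun a b => (if a ∈ I then (if b ∈ J then k else 0) else 0) -
    (if a = i then (if b = j then x else 0) else 0)

theorem mInner_blockSubEntry (I : Finset (Fin m)) (J : Finset (Fin n)) (k : ℝ) (i : Fin m)
    (j : Fin n) (x : ℝ) (Y : Matrix (Fin m) (Fin n) ℝ) :
    mInner (blockSubEntry I J k i j x) Y = k * ∑ a ∈ I, ∑ b ∈ J, Y a b - x * Y i j := by
  have h1 : ∑ a, ∑ b, (if a ∈ I then (if b ∈ J then k else 0) else 0) * Y a b =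
      k * ∑ a ∈ I, ∑ b ∈ J, Y a b := by
    rw [Finset.mul_sum, ← Finset.sum_subset (Finset.subset_univ I)]
    · refine Finset.sum_congr rfl fun a ha => ?_
      simp [ha, Finset.mul_sum]
    · intro a _ ha
      simp [ha]
  have h2 : ∑ a, ∑ b, (if a = i then (if b = j then x else 0) else 0) * Y a b = x * Y i j := by
    rw [Finset.sum_eq_single i (fun a _ ha => by simp [ha]) (by simp)]
    simp
  simp only [mInner, blockSubEntry, Matrix.of_apply, sub_mul, Finset.sum_sub_distrib, h1, h2]

/-- Removing the entry `(i,j)` of `X` and adding a nonnegative constant `k` on the block `I×J`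
changes the `ℓ1` norm by at most `k|I||J| - |X i j|`. -/
theorem l1Norm_add_blockSubEntry_le (X : Matrix (Fin m) (Fin n) ℝ) (I : Finset (Fin m))
    (J : Finset (Fin n)) {k : ℝ} (hk : 0 ≤ k) (i : Fin m) (j : Fin n) :
    l1Norm (X + blockSubEntry I J k i j (X i j)) ≤
      l1Norm X + (k * (I.card * J.card) - |X i j|) := by
  have hsum : mInner (blockSubEntry I J k i j |X i j|) (Matrix.of fun _ _ => 1) =
      k * (I.card * J.card) - |X i j| := by
    rw [mInner_blockSubEntry]
    simp
  rw [← hsum, l1Norm, l1Norm, mInner, ← Finset.sum_add_distrib]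
  refine Finset.sum_le_sum fun a _ => ?_
  rw [← Finset.sum_add_distrib]
  refine Finset.sum_le_sum fun b _ => ?_
  have hF : 0 ≤ (if a ∈ I then (if b ∈ J then k else 0) else 0) := by
    split_ifs <;> simp [hk]
  simp only [Matrix.add_apply, blockSubEntry, Matrix.of_apply, mul_one]
  generalize (if a ∈ I then (if b ∈ J then k else 0) else 0) = f at hF
  by_cases hab : a = i ∧ b = j
  · obtain ⟨rfl, rfl⟩ := hab
    simp [abs_of_nonneg hF]
  · have hz : ∀ y : ℝ, (if a = i then (if b = j then y else 0) else 0) = 0 := by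
      intro y
      split_ifs <;> tauto
    rw [hz, hz]
    simpa [abs_of_nonneg hF] using abs_add_le (X a b) f

theorem stmt16 (A : Matrix (Fin m) (Fin n) ℝ)
    (hA0 : A ≠ 0) (hAnn : ∀ i j, 0 ≤ A i j)
    (I : Finset (Fin m)) (J : Finset (Fin n))
    (abar amax : ℝ)
    (habar : abar = (1 / ((I.card : ℝ) * (J.card : ℝ))) * ∑ i ∈ I, ∑ j ∈ J, A i j)
    (hamax : amax = sSup {r | ∃ i j, (i ∉ I ∨ j ∉ J) ∧ r = A i j})
    (hgap : amax < abar)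
    (θ : ℝ)
    (hθ : (1 / Real.sqrt ((I.card : ℝ) * (J.card : ℝ))) *
        ((abar * Real.sqrt ((I.card : ℝ) * (J.card : ℝ)) + amax) / (abar - amax)) < θ)
    (X : Matrix (Fin m) (Fin n) ℝ) (hopt : IsOptMax (thetaNorm θ) A X) :
    ∀ i j, (i ∉ I ∨ j ∉ J) → X i j = 0 := by
  subst hamax
  intro i j hij
  by_contra hx
  set amax := sSup {r | ∃ i j, (i ∉ I ∨ j ∉ J) ∧ r = A i j}
  have hamax_ge : A i j ≤ amax := by
    refine le_csSup ⟨∑ a, ∑ b, A a b, ?_⟩ ⟨i, j, hij, rfl⟩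
    rintro r ⟨a, b, -, rfl⟩
    exact (Finset.single_le_sum (fun b _ => hAnn a b) (Finset.mem_univ b)).trans
      (Finset.single_le_sum (f := fun a => ∑ b, A a b)
        (fun a _ => Finset.sum_nonneg fun b _ => hAnn a b) (Finset.mem_univ a))
  have hamax0 : 0 ≤ amax := (hAnn i j).trans hamax_ge
  have habar0 : 0 < abar := hamax0.trans_lt hgap
  have hI : I.Nonempty := by
    by_contra h
    simp [Finset.not_nonempty_iff_eq_empty.1 h] at habar
    exact habar0.ne' habar
  have hJ : J.Nonempty := by
    by_contra h
    simp [Finset.not_nonempty_iff_eq_empty.1 h] at habar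
    exact habar0.ne' habar
  have hMN : (0 : ℝ) < (I.card : ℝ) * J.card := by
    exact_mod_cast mul_pos hI.card_pos hJ.card_pos
  have hsum : ∑ a ∈ I, ∑ b ∈ J, A a b = (I.card : ℝ) * J.card * abar := by
    rw [habar, one_div, mul_inv_cancel_left₀ hMN.ne']
  set s := √((I.card : ℝ) * J.card) with hs
  have hs0 : 0 < s := Real.sqrt_pos.2 hMN
  have hs2 : (I.card : ℝ) * J.card = s * s := (Real.mul_self_sqrt hMN.le).symm
  clear_value s
  have hgap0 : 0 < abar - amax := sub_pos.2 hgap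
  have hθs : abar * s + amax < θ * s * (abar - amax) := by
    rw [one_div, inv_mul_lt_iff₀ hs0, div_lt_iff₀ hgap0] at hθ
    linarith
  have hθ1 : 1 < θ := by
    by_contra! h
    have : θ * (s * (abar - amax)) ≤ 1 * (s * (abar - amax)) := by gcongr
    nlinarith [mul_nonneg hs0.le hamax0]
  have hθ0 : 0 < θ := by linarith
  have hden : 0 < 1 + θ * s := by positivity
  have hx0 : 0 < |X i j| := abs_pos.2 hx
  obtain ⟨k, hk0, hk⟩ : ∃ k, 0 ≤ k ∧ k * s * (1 + θ * s) = |X i j| * (θ - 1) := by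
    refine ⟨|X i j| * (θ - 1) / (s * (1 + θ * s)), ?_, by field_simp⟩
    have : 0 ≤ θ - 1 := by linarith
    positivity
  have hnuc : nuclearNorm (X + blockSubEntry I J k i j (X i j)) ≤
      nuclearNorm X + (k * s + |X i j|) := by
    refine nuclearNorm_add_le _ _ fun Y hY => ?_
    have hblock : ∑ a ∈ I, ∑ b ∈ J, Y a b ≤ s :=
      (sum_block_le_spectralNorm Y hI hJ).trans (hs ▸ mul_le_of_le_one_right hs0.le hY)
    have hentry : -(X i j * Y i j) ≤ |X i j| := by
      calc -(X i j * Y i j) ≤ |X i j| * |Y i j| := (neg_le_abs _).trans (abs_mul _ _).le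
        _ ≤ |X i j| := mul_le_of_le_one_right (abs_nonneg _)
            ((abs_apply_le_spectralNorm Y i j).trans hY)
    rw [mInner_blockSubEntry]
    linarith [mul_le_mul_of_nonneg_left hblock hk0]
  have hl1 := l1Norm_add_blockSubEntry_le X I J hk0 i j
  have hfeas : thetaNorm θ (X + blockSubEntry I J k i j (X i j)) ≤ 1 := by
    have hX : nuclearNorm X + θ * l1Norm X ≤ 1 := hopt.1
    rw [hs2] at hl1
    have := mul_le_mul_of_nonneg_left hl1 hθ0.le
    unfold thetaNorm
    linarith
  have hle := hopt.2 _ hfeas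
  have hcomm : ∀ Z, mInner A Z = mInner Z A := fun Z => by simp only [mInner, mul_comm]
  rw [hcomm, hcomm, mInner_add_left, mInner_blockSubEntry, hsum, hs2] at hle
  have hxa : X i j * A i j ≤ |X i j| * amax :=
    mul_le_mul (le_abs_self _) hamax_ge (hAnn i j) (abs_nonneg _)
  have hbound : |X i j| * ((θ - 1) * s * abar) ≤ |X i j| * (amax * (1 + θ * s)) := by
    calc |X i j| * ((θ - 1) * s * abar) = k * (s * s * abar) * (1 + θ * s) := by
          linear_combination (-s * abar) * hk
      _ ≤ |X i j| * amax * (1 + θ * s) := by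
          refine mul_le_mul_of_nonneg_right ?_ hden.le
          linarith
      _ = |X i j| * (amax * (1 + θ * s)) := by ring
  linarith [le_of_mul_le_mul_left hbound hx0]

end LAROS
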